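/- Let φ ∈ C²(ℝ²) and let (y₁*, y₂*) ∈ ℝ² satisfy ∂φ/∂y₁(y₁*, y₂*) = 0, ∂φ/∂y₂(y₁*, y₂*) > 0, and ∂²φ/∂y₁²(y₁*, y₂*) < 0. Set t := φ(y₁*, y₂*) and c := √( 2·∂φ/∂y₂(y₁*, y₂*) / (−∂²φ/∂y₁²(y₁*, y₂*)) ). Then there exist δ > 0 and δ' > 0 such that the function g(y₂) := ∫_{y₁*−δ}^{y₁*+δ} ind(φ(y₁, y₂) − t) ρ(y₁) dy₁ satisfies: (i) g(y₂) = 0 for all y₂ ∈ (y₂* − δ', y₂*], and (ii) g(y₂)/√(y₂ − y₂*) → 2c·ρ(y₁*) as y₂ → y₂*⁺. In particular, g has an infinite one-sided (right) derivative at y₂*, i.e., a square-root singularity. -/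

import Mathlib

open Filter Topology Set

/-- The standard normal density. -/
noncomputable def ρ (y : ℝ) : ℝ := Real.exp (-y ^ 2 / 2) / Real.sqrt (2 * Real.pi)

/-- The indicator `ind u = 1` if `u > 0` and `0` otherwise. -/
noncomputable def ind (u : ℝ) : ℝ := if 0 < u then 1 else 0

open MeasureTheory in
lemma aux_expansion (φ : ℝ × ℝ → ℝ) (hφ : ContDiff ℝ 2 φ) (a b : ℝ)
    (h1 : deriv (fun s => φ (s, b)) a = 0) (ε : ℝ) (hε : 0 < ε) :
    ∀ᶠ p : ℝ × ℝ in 𝓝 (a, b),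
      |φ p - φ (a, b) - deriv (fun s => φ (a, s)) b * (p.2 - b)
        - iteratedDeriv 2 (fun s => φ (s, b)) a / 2 * (p.1 - a) ^ 2|
        ≤ ε * (|p.2 - b| + (p.1 - a) ^ 2) := by
  have hs : HasStrictFDerivAt φ (fderiv ℝ φ (a, b)) (a, b) :=
    hφ.contDiffAt.hasStrictFDerivAt (by norm_num)
  have hA : deriv (fun s => φ (a, s)) b = fderiv ℝ φ (a, b) (0, 1) := by
    have h : HasDerivAt (fun s : ℝ => ((a, s) : ℝ × ℝ)) (0, 1) b :=
      (hasDerivAt_const b a).prodMk (hasDerivAt_id b)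
    exact (HasFDerivAt.comp_hasDerivAt (x := b) (l := φ) (f := fun s : ℝ => ((a, s) : ℝ × ℝ))
      hs.hasFDerivAt h).deriv
  have e1 := (hs.isLittleO).def hε
  have t1 : Tendsto (fun p : ℝ × ℝ => (p, ((p.1, b) : ℝ × ℝ))) (𝓝 (a, b))
      (𝓝 ((a, b), (a, b))) := by
    have : Continuous (fun p : ℝ × ℝ => (p, ((p.1, b) : ℝ × ℝ))) := by fun_prop
    exact this.tendsto' _ _ rfl
  have e1' := t1.eventually e1
  have hf : ContDiff ℝ 2 (fun s => φ (s, b)) := hφ.comp (by fun_prop)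
  have e2 := (taylor_isLittleO_univ (x₀ := a) (n := 2) hf).def hε
  have t2 : Tendsto (fun p : ℝ × ℝ => p.1) (𝓝 (a, b)) (𝓝 a) :=
    continuous_fst.tendsto' _ _ rfl
  have e2' := t2.eventually e2
  filter_upwards [e1', e2'] with p hp1 hp2
  obtain ⟨x, y⟩ := p
  simp only [taylorWithinEval_succ, taylor_within_zero_eval, iteratedDerivWithin_univ] at hp2
  have hv : ((x, y) : ℝ × ℝ) - (x, b) = (y - b) • ((0, 1) : ℝ × ℝ) := by
    ext <;> simp
  simp only [hv, map_smul, ← hA, norm_smul] at hp1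
  have hn : ‖((0, 1) : ℝ × ℝ)‖ = 1 := by simp [Prod.norm_def]
  rw [hn] at hp1
  simp only [Real.norm_eq_abs, smul_eq_mul, mul_one] at hp1 hp2
  norm_num at hp2
  rw [h1] at hp2
  simp only
  rw [abs_le] at *
  constructor <;> nlinarith [hp1.1, hp1.2, hp2.1, hp2.2]

lemma aux_box (φ : ℝ × ℝ → ℝ) (hφ : ContDiff ℝ 2 φ) (a b : ℝ)
    (h1 : deriv (fun s => φ (s, b)) a = 0) (ε : ℝ) (hε : 0 < ε) :
    ∃ r > (0 : ℝ), ∀ x y, |x - a| ≤ r → |y - b| ≤ r →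
      |φ (x, y) - φ (a, b) - deriv (fun s => φ (a, s)) b * (y - b)
        - iteratedDeriv 2 (fun s => φ (s, b)) a / 2 * (x - a) ^ 2|
        ≤ ε * (|y - b| + (x - a) ^ 2) := by
  obtain ⟨r, hr, h⟩ := Metric.eventually_nhds_iff.1 (aux_expansion φ hφ a b h1 ε hε)
  refine ⟨r / 2, by positivity, fun x y hx hy => ?_⟩
  refine h (y := (x, y)) ?_
  rw [Prod.dist_eq, Real.dist_eq, Real.dist_eq]
  exact max_lt (by linarith) (by linarith)

lemma aux_rho_pos (x : ℝ) : 0 < ρ x := by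
  unfold ρ; positivity

lemma aux_rho_le (x : ℝ) : ρ x ≤ ρ 0 := by
  unfold ρ
  have h : -x ^ 2 / 2 ≤ -(0 : ℝ) ^ 2 / 2 := by nlinarith [sq_nonneg x]
  exact div_le_div_of_nonneg_right (Real.exp_le_exp.2 h) (Real.sqrt_nonneg _)

lemma aux_rho_cont : Continuous ρ := by
  unfold ρ; fun_prop

lemma aux_ind_meas : Measurable ind := by
  unfold ind
  exact Measurable.ite measurableSet_Ioi measurable_const measurable_const

open MeasureTheory in
lemma aux_main (φ : ℝ × ℝ → ℝ) (hφ : ContDiff ℝ 2 φ) (a b A B δ : ℝ)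
    (hA : 0 < A) (hB : 0 < B) (hδ : 0 < δ)
    (hloc : ∀ ε > 0, ∃ r > (0 : ℝ), ∀ x y, |x - a| ≤ r → |y - b| ≤ r →
      |φ (x, y) - φ (a, b) - A * (y - b) + B / 2 * (x - a) ^ 2| ≤ ε * (|y - b| + (x - a) ^ 2))
    (hup : ∀ x y, |x - a| ≤ δ → |y - b| ≤ δ → b < y → 0 < φ (x, y) - φ (a, b) →
      (x - a) ^ 2 ≤ 8 * A / B * (y - b)) :
    Tendsto (fun y => (∫ x in (a - δ)..(a + δ), ind (φ (x, y) - φ (a, b)) * ρ x) /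
      Real.sqrt (y - b)) (𝓝[>] b) (𝓝 (2 * Real.sqrt (2 * A / B) * ρ a)) := by
  set c := Real.sqrt (2 * A / B) with hc
  have hc2 : c ^ 2 = 2 * A / B := Real.sq_sqrt (by positivity)
  have hc0 : 0 < c := Real.sqrt_pos.2 (by positivity)
  set K := 8 * A / B with hK
  have hK0 : 0 < K := by positivity
  let F : ℝ → ℝ → ℝ := fun y => (Ioc (-(δ / √(y - b))) (δ / √(y - b))).indicator
    (fun v => ind (φ (a + √(y - b) * v, y) - φ (a, b)) * ρ (a + √(y - b) * v))
  have hspos : ∀ y, b < y → 0 < √(y - b) := fun y hy => Real.sqrt_pos.2 (by linarith)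
  have hFeq : ∀ y, b < y → (∫ x in (a - δ)..(a + δ), ind (φ (x, y) - φ (a, b)) * ρ x) /
      √(y - b) = ∫ v, F y v := by
    intro y hy
    have hs := hspos y hy
    have hle : -(δ / √(y - b)) ≤ δ / √(y - b) := by
      have : 0 < δ / √(y - b) := by positivity
      linarith
    rw [integral_indicator measurableSet_Ioc, ← intervalIntegral.integral_of_le hle,
      intervalIntegral.integral_comp_add_mul (fun x => ind (φ (x, y) - φ (a, b)) * ρ x) hs.ne' a]
    have h1 : a + √(y - b) * -(δ / √(y - b)) = a - δ := by field_simp; ring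
    have h2 : a + √(y - b) * (δ / √(y - b)) = a + δ := by field_simp
    rw [h1, h2, smul_eq_mul, div_eq_inv_mul]
  have hlim : 2 * c * ρ a = ∫ v, (Ioo (-c) c).indicator (fun _ => ρ a) v := by
    rw [integral_indicator_const _ measurableSet_Ioo]
    simp only [Measure.real, Real.volume_Ioo, smul_eq_mul]
    rw [ENNReal.toReal_ofReal (by linarith)]
    ring
  have hst : Tendsto (fun y => √(y - b)) (𝓝[>] b) (𝓝 0) := by
    have : Continuous (fun y => √(y - b)) := by fun_prop
    exact (this.tendsto' b 0 (by simp)).mono_left nhdsWithin_le_nhds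
  have hyt : Tendsto (fun y : ℝ => y - b) (𝓝[>] b) (𝓝 0) := by
    have : Continuous (fun y : ℝ => y - b) := by fun_prop
    exact (this.tendsto' b 0 (by simp)).mono_left nhdsWithin_le_nhds
  rw [hlim]
  have hev : (fun y => ∫ v, F y v) =ᶠ[𝓝[>] b]
      (fun y => (∫ x in (a - δ)..(a + δ), ind (φ (x, y) - φ (a, b)) * ρ x) / √(y - b)) := by
    filter_upwards [self_mem_nhdsWithin] with y hy
    exact (hFeq y hy).symm
  refine Tendsto.congr' hev ?_
  refine tendsto_integral_filter_of_dominated_convergence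
    ((Icc (-(K + 1)) (K + 1)).indicator (fun _ => ρ 0)) ?_ ?_ ?_ ?_
  · refine Eventually.of_forall fun y => ?_
    refine (Measurable.indicator ?_ measurableSet_Ioc).aestronglyMeasurable
    have hcφ := hφ.continuous
    have hcρ := aux_rho_cont
    refine (aux_ind_meas.comp ?_).mul ?_
    · exact Continuous.measurable (by fun_prop)
    · exact Continuous.measurable (by fun_prop)
  · filter_upwards [self_mem_nhdsWithin, hyt.eventually (Iio_mem_nhds hδ)] with y hy hyd
    refine Eventually.of_forall fun v => ?_
    have hy' : b < y := hy
    have hyd' : y - b < δ := hyd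
    have hs := hspos y hy
    have hb0 : 0 ≤ (Icc (-(K + 1)) (K + 1)).indicator (fun _ => ρ 0) v :=
      indicator_nonneg (fun _ _ => (aux_rho_pos 0).le) v
    by_cases hv : v ∈ Ioc (-(δ / √(y - b))) (δ / √(y - b))
    · simp only [F, indicator_of_mem hv]
      unfold ind
      split_ifs with hp
      · have hx : |a + √(y - b) * v - a| ≤ δ := by
          rw [add_sub_cancel_left, abs_mul, abs_of_pos hs, mul_comm, ← le_div_iff₀ hs]
          exact abs_le.2 ⟨hv.1.le, hv.2⟩
        have h := hup _ y hx (by rw [abs_of_pos] <;> linarith) hy' hp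
        have hsq : √(y - b) ^ 2 = y - b := Real.sq_sqrt (by linarith)
        have h2 : v ^ 2 ≤ K := by
          have : (y - b) * v ^ 2 ≤ (y - b) * K := by
            rw [add_sub_cancel_left, mul_pow, hsq] at h
            linarith
          exact le_of_mul_le_mul_left this (by linarith)
        have hmem : v ∈ Icc (-(K + 1)) (K + 1) := by
          constructor <;> nlinarith
        rw [indicator_of_mem hmem, one_mul, Real.norm_eq_abs, abs_of_pos (aux_rho_pos _)]
        exact aux_rho_le _
      · simpa using hb0
    · simp only [F, indicator_of_notMem hv, norm_zero]
      exact hb0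
  · exact (integrable_indicator_iff measurableSet_Icc).2
      (integrableOn_const (by simp [Real.volume_Icc]))
  · have hae : ∀ᵐ v : ℝ, v ∉ ({c, -c} : Set ℝ) :=
      measure_eq_zero_iff_ae_notMem.1 ((Set.toFinite {c, -c}).measure_zero volume)
    filter_upwards [hae] with v hv
    simp only [mem_insert_iff, mem_singleton_iff, not_or] at hv
    set q := A - B / 2 * v ^ 2 with hq
    have hqc : q = B / 2 * (c ^ 2 - v ^ 2) := by rw [hc2, hq]; field_simp
    have hq0 : q ≠ 0 := by
      rw [hqc]
      have h1 : c ^ 2 - v ^ 2 = (c - v) * (c + v) := by ring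
      rw [h1]
      refine mul_ne_zero (by positivity) (mul_ne_zero ?_ ?_)
      · intro h; exact hv.1 (by linarith)
      · intro h; exact hv.2 (by linarith)
    have hqa : 0 < |q| := abs_pos.2 hq0
    obtain ⟨r, hr, hbox⟩ := hloc (|q| / (2 * (1 + v ^ 2))) (by positivity)
    have hsv : Tendsto (fun y => √(y - b) * |v|) (𝓝[>] b) (𝓝 0) := by
      simpa using hst.mul_const |v|
    have key : ∀ᶠ y in 𝓝[>] b, F y v = (if 0 < q then 1 else 0) * ρ (a + √(y - b) * v) := by
      filter_upwards [self_mem_nhdsWithin, hyt.eventually (Iio_mem_nhds hr),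
        hsv.eventually (Iio_mem_nhds hr), hsv.eventually (Iio_mem_nhds hδ)] with y hy h1 h2 h3
      have hy' : b < y := hy
      have h1' : y - b < r := h1
      have h2' : √(y - b) * |v| < r := h2
      have h3' : √(y - b) * |v| < δ := h3
      have hs := hspos y hy
      have hv' : v ∈ Ioc (-(δ / √(y - b))) (δ / √(y - b)) := by
        have : |v| < δ / √(y - b) := by rw [lt_div_iff₀ hs, mul_comm]; exact h3'
        exact ⟨(abs_lt.1 this).1, (abs_lt.1 this).2.le⟩
      simp only [F, indicator_of_mem hv']
      have hsq : √(y - b) ^ 2 = y - b := Real.sq_sqrt (by linarith)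
      have h := hbox (a + √(y - b) * v) y
        (by rw [add_sub_cancel_left, abs_mul, abs_of_pos hs]; exact h2'.le)
        (by rw [abs_of_pos] <;> linarith)
      rw [add_sub_cancel_left, mul_pow, hsq, abs_of_pos (sub_pos.2 hy')] at h
      have e : |q| / (2 * (1 + v ^ 2)) * (y - b + (y - b) * v ^ 2) = |q| / 2 * (y - b) := by
        field_simp
      rw [e] at h
      have hyb : 0 < y - b := sub_pos.2 hy'
      have h' := abs_le.1 h
      congr 1
      unfold ind
      rcases lt_or_gt_of_ne hq0 with hneg | hpos
      · rw [abs_of_neg hneg] at h'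
        have hm := mul_neg_of_neg_of_pos hneg hyb
        rw [if_neg, if_neg (not_lt.2 hneg.le)]
        have : q * (y - b) = A * (y - b) - B / 2 * ((y - b) * v ^ 2) := by rw [hq]; ring
        linarith [h'.1, h'.2]
      · rw [abs_of_pos hpos] at h'
        have hm := mul_pos hpos hyb
        rw [if_pos, if_pos hpos]
        have : q * (y - b) = A * (y - b) - B / 2 * ((y - b) * v ^ 2) := by rw [hq]; ring
        linarith [h'.1, h'.2]
    have hval : (Ioo (-c) c).indicator (fun _ => ρ a) v = (if 0 < q then 1 else 0) * ρ a := by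
      by_cases hm : v ∈ Ioo (-c) c
      · have : 0 < q := by
          rw [hqc]
          have : 0 < c ^ 2 - v ^ 2 := by nlinarith [hm.1, hm.2]
          positivity
        rw [indicator_of_mem hm, if_pos this, one_mul]
      · have : ¬ 0 < q := by
          intro h
          rw [hqc] at h
          have h2 : 0 < c ^ 2 - v ^ 2 := pos_of_mul_pos_right h (by positivity)
          have := abs_lt_of_sq_lt_sq (by linarith : v ^ 2 < c ^ 2) hc0.le
          exact hm ⟨(abs_lt.1 this).1, (abs_lt.1 this).2⟩
        rw [indicator_of_notMem hm, if_neg this, zero_mul]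
    rw [hval]
    refine Tendsto.congr' (key.mono fun y hy => hy.symm) (Tendsto.const_mul _ ?_)
    refine (aux_rho_cont.tendsto a).comp ?_
    simpa using (hst.mul_const v).const_add a

/-- **Theorem 1 of the paper (square-root singularity), local two-dimensional form.**
If `φ ∈ C²(ℝ²)`, `∂φ/∂y₁(y₁*,y₂*) = 0`, `∂φ/∂y₂(y₁*,y₂*) > 0`, `∂²φ/∂y₁²(y₁*,y₂*) < 0`,
and `t := φ(y₁*,y₂*)`, `c := √(2 ∂φ/∂y₂(y₁*,y₂*) / (−∂²φ/∂y₁²(y₁*,y₂*)))`, then there are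
`δ, δ' > 0` so that `g(y₂) := ∫_{y₁*−δ}^{y₁*+δ} ind(φ(y₁,y₂) − t) ρ(y₁) dy₁` vanishes for
`y₂ ∈ (y₂*−δ', y₂*]`, satisfies `g(y₂)/√(y₂−y₂*) → 2 c ρ(y₁*)` as `y₂ → y₂*⁺`, and hence has
an infinite one-sided (right) derivative at `y₂*`: a square-root singularity. -/
theorem preintegration_sqrt_singularity
    (φ : ℝ × ℝ → ℝ) (hφ : ContDiff ℝ 2 φ) (y₁s y₂s : ℝ)
    (h1 : deriv (fun s => φ (s, y₂s)) y₁s = 0)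
    (h2 : 0 < deriv (fun s => φ (y₁s, s)) y₂s)
    (h3 : iteratedDeriv 2 (fun s => φ (s, y₂s)) y₁s < 0) :
    ∃ δ > (0 : ℝ), ∃ δ' > (0 : ℝ),
      (∀ y₂ ∈ Set.Ioc (y₂s - δ') y₂s,
        (∫ y₁ in (y₁s - δ)..(y₁s + δ), ind (φ (y₁, y₂) - φ (y₁s, y₂s)) * ρ y₁) = 0) ∧
      Tendsto
        (fun y₂ => (∫ y₁ in (y₁s - δ)..(y₁s + δ), ind (φ (y₁, y₂) - φ (y₁s, y₂s)) * ρ y₁) /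
          Real.sqrt (y₂ - y₂s))
        (𝓝[>] y₂s)
        (𝓝 (2 * Real.sqrt (2 * deriv (fun s => φ (y₁s, s)) y₂s /
          (- iteratedDeriv 2 (fun s => φ (s, y₂s)) y₁s)) * ρ y₁s)) ∧
      Tendsto
        (fun y₂ => (∫ y₁ in (y₁s - δ)..(y₁s + δ), ind (φ (y₁, y₂) - φ (y₁s, y₂s)) * ρ y₁) /
          (y₂ - y₂s))
        (𝓝[>] y₂s) atTop := by
  set A := deriv (fun s => φ (y₁s, s)) y₂s with hA
  set D := iteratedDeriv 2 (fun s => φ (s, y₂s)) y₁s with hD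
  obtain ⟨B, hB⟩ : ∃ B, B = -D := ⟨_, rfl⟩
  have hB0 : 0 < B := by linarith
  have hloc : ∀ ε > 0, ∃ r > (0 : ℝ), ∀ x y, |x - y₁s| ≤ r → |y - y₂s| ≤ r →
      |φ (x, y) - φ (y₁s, y₂s) - A * (y - y₂s) + B / 2 * (x - y₁s) ^ 2|
        ≤ ε * (|y - y₂s| + (x - y₁s) ^ 2) := by
    intro ε hε
    obtain ⟨r, hr, h⟩ := aux_box φ hφ y₁s y₂s h1 ε hε
    refine ⟨r, hr, fun x y hx hy => ?_⟩
    have h' := h x y hx hy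
    rw [← hA, ← hD] at h'
    have e : φ (x, y) - φ (y₁s, y₂s) - A * (y - y₂s) + B / 2 * (x - y₁s) ^ 2
      = φ (x, y) - φ (y₁s, y₂s) - A * (y - y₂s) - D / 2 * (x - y₁s) ^ 2 := by rw [hB]; ring
    rw [e]; exact h'
  obtain ⟨ε, hε, hεA, hεB⟩ : ∃ ε > 0, ε ≤ A ∧ ε ≤ B / 4 :=
    ⟨min A (B / 4), lt_min h2 (by positivity), min_le_left _ _, min_le_right _ _⟩
  obtain ⟨δ, hδ, hbox⟩ := hloc ε hε
  have hup : ∀ x y, |x - y₁s| ≤ δ → |y - y₂s| ≤ δ → y₂s < y →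
      0 < φ (x, y) - φ (y₁s, y₂s) → (x - y₁s) ^ 2 ≤ 8 * A / B * (y - y₂s) := by
    intro x y hx hy hlt hp
    have h := (abs_le.1 (hbox x y hx hy)).2
    rw [abs_of_pos (sub_pos.2 hlt)] at h
    have i1 := mul_le_mul_of_nonneg_right hεA (sub_pos.2 hlt).le
    have i2 := mul_le_mul_of_nonneg_right hεB (sq_nonneg (x - y₁s))
    rw [div_mul_eq_mul_div, le_div_iff₀ hB0]
    linarith
  have main := aux_main φ hφ y₁s y₂s A B δ h2 hB0 hδ hloc hup
  rw [← hB]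
  refine ⟨δ, hδ, δ, hδ, ?_, main, ?_⟩
  · intro y hy
    rw [← intervalIntegral.integral_zero (a := y₁s - δ) (b := y₁s + δ)]
    refine intervalIntegral.integral_congr fun x hx => ?_
    rw [uIcc_of_le (by linarith)] at hx
    have hx' : |x - y₁s| ≤ δ := abs_le.2 ⟨by linarith [hx.1], by linarith [hx.2]⟩
    have hy' : |y - y₂s| ≤ δ := abs_le.2 ⟨by linarith [hy.1], by linarith [hy.2]⟩
    have h := (abs_le.1 (hbox x y hx' hy')).2
    rw [abs_of_nonpos (by linarith [hy.2])] at h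
    have i1 := mul_le_mul_of_nonneg_right hεA (by linarith [hy.2] : 0 ≤ -(y - y₂s))
    have i2 := mul_le_mul_of_nonneg_right hεB (sq_nonneg (x - y₁s))
    have i3 : 0 ≤ B * (x - y₁s) ^ 2 := by positivity
    have hn : ¬ 0 < φ (x, y) - φ (y₁s, y₂s) := by
      rw [not_lt]; linarith
    simp only [ind, if_neg hn, zero_mul]
  · have hpos : 0 < 2 * Real.sqrt (2 * A / B) * ρ y₁s := by
      have := aux_rho_pos y₁s
      positivity
    have hst : Tendsto (fun y => Real.sqrt (y - y₂s)) (𝓝[>] y₂s) (𝓝[>] 0) := by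
      refine tendsto_nhdsWithin_iff.2 ⟨?_, ?_⟩
      · have : Continuous (fun y => Real.sqrt (y - y₂s)) := by fun_prop
        exact (this.tendsto' y₂s 0 (by simp)).mono_left nhdsWithin_le_nhds
      · filter_upwards [self_mem_nhdsWithin] with y hy
        exact Real.sqrt_pos.2 (sub_pos.2 hy)
    have hinv := tendsto_inv_nhdsGT_zero.comp hst
    refine Tendsto.congr' ?_ (main.pos_mul_atTop hpos hinv)
    filter_upwards [self_mem_nhdsWithin] with y hy
    have hy0 : 0 ≤ y - y₂s := (sub_pos.2 hy).le
    simp only [Function.comp]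
    rw [← div_eq_mul_inv, div_div, Real.mul_self_sqrt hy0]
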